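/- arXiv:2210.04364 — 3 statements merged into one kernel-verified Lean document; each statement's English description precedes it below -/
import Mathlib

section
/- Let f be a locally Lipschitz function on an open connected set Ω ⊆ ℝⁿ satisfying |∇f(x)| ≤ V(x)|f(x)| for a.e. x ∈ Ω, where V ∈ L^n_loc(Ω). If f(x₀) = 0 for some x₀ ∈ Ω, then f ≡ 0 on Ω. -/
open MeasureTheory Set

/-- The regularized logarithm `u ↦ log (u² + δ²) / 2` has derivative `u / (u² + δ²)`. -/
lemma hasDerivAt_log_sq_add_sq {δ : ℝ} (hδ : 0 < δ) (u : ℝ) :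
    HasDerivAt (fun u : ℝ => Real.log (u ^ 2 + δ ^ 2) / 2) (u / (u ^ 2 + δ ^ 2)) u := by
  have hpos : u ^ 2 + δ ^ 2 ≠ 0 := by positivity
  have h := ((((hasDerivAt_id u).pow 2).add_const (δ ^ 2)).log (by simpa using hpos)).div_const 2
  refine h.congr_deriv ?_
  simp
  field_simp

/-- The regularized logarithm is `δ⁻¹`-Lipschitz. -/
lemma lipschitzWith_log_sq_add_sq {δ : ℝ} (hδ : 0 < δ) :
    LipschitzWith (Real.toNNReal δ⁻¹) (fun u : ℝ => Real.log (u ^ 2 + δ ^ 2) / 2) := by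
  refine lipschitzWith_of_nnnorm_deriv_le
    (fun u => (hasDerivAt_log_sq_add_sq hδ u).differentiableAt) fun u => ?_
  rw [(hasDerivAt_log_sq_add_sq hδ u).deriv, ← NNReal.coe_le_coe, coe_nnnorm,
    Real.coe_toNNReal _ (by positivity), Real.norm_eq_abs, abs_div,
    abs_of_pos (by positivity : 0 < u ^ 2 + δ ^ 2), inv_eq_one_div,
    div_le_div_iff₀ (by positivity) hδ]
  nlinarith [sq_nonneg (|u| - δ), sq_abs u, abs_nonneg u]

/-- The regularized logarithm of `g` has gradient at most `|∇g| / |g|`. -/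
lemma norm_fderiv_log_sq_add_sq_le {E : Type*} [NormedAddCommGroup E] [NormedSpace ℝ E]
    {g : E → ℝ} {δ : ℝ} (hδ : 0 < δ) {x : E}
    (hg : DifferentiableAt ℝ g x) :
    ‖fderiv ℝ (fun x => Real.log (g x ^ 2 + δ ^ 2) / 2) x‖ ≤ ‖fderiv ℝ g x‖ / |g x| := by
  have h := (hasDerivAt_log_sq_add_sq hδ (g x)).comp_hasFDerivAt x hg.hasFDerivAt
  have h' : fderiv ℝ (fun x => Real.log (g x ^ 2 + δ ^ 2) / 2) x =
      (g x / (g x ^ 2 + δ ^ 2)) • fderiv ℝ g x := h.fderiv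
  rw [h', norm_smul, Real.norm_eq_abs, mul_comm]
  refine (mul_le_mul_of_nonneg_left ?_ (norm_nonneg _)).trans_eq (div_eq_mul_inv _ _).symm
  rcases eq_or_ne (g x) 0 with h0 | h0
  · simp [h0]
  · have : 0 < |g x| := abs_pos.2 h0
    rw [abs_div, abs_of_pos (by positivity : 0 < g x ^ 2 + δ ^ 2), inv_eq_one_div,
      div_le_div_iff₀ (by positivity) this]
    nlinarith [sq_abs (g x), sq_nonneg δ]

/-- A form of Young's inequality without optimal constants. -/
lemma le_add_pow_div_pow {u c : ℝ} (hu : 0 ≤ u) (hc : 0 < c) {n : ℕ} (hn : n ≠ 0) :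
    u ≤ c + u ^ n / c ^ (n - 1) := by
  rcases le_total u c with h | h
  · exact h.trans (le_add_of_nonneg_right (by positivity))
  · obtain ⟨m, rfl⟩ := Nat.exists_eq_succ_of_ne_zero hn
    refine le_trans ?_ (le_add_of_nonneg_left hc.le)
    rw [le_div_iff₀ (by positivity), Nat.succ_eq_add_one, Nat.add_sub_cancel, pow_succ, mul_comm]
    gcongr

section Dilation

variable {E : Type*} [NormedAddCommGroup E] [NormedSpace ℝ E] [FiniteDimensional ℝ E]
  [MeasurableSpace E] [BorelSpace E] {μ : Measure E} [μ.IsAddHaarMeasure]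

/-- The dilated averages of a Lipschitz function over a bounded set are differentiable at
every positive scale. -/
lemma hasDerivAt_setIntegral_comp_smul {G : E → ℝ} {C : NNReal} (hG : LipschitzWith C G)
    {A : Set E} (hA : MeasurableSet A) {R : ℝ} (hAR : A ⊆ Metric.ball 0 R) {t : ℝ} (ht : 0 < t) :
    HasDerivAt (fun t : ℝ => ∫ z in A, G (t • z) ∂μ)
      (∫ z in A, fderiv ℝ G (t • z) z ∂μ) t := by
  have hAfin : μ A < ⊤ := (measure_mono hAR).trans_lt measure_ball_lt_top
  have hint : ∀ t : ℝ, IntegrableOn (fun z => G (t • z)) A μ := fun t =>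
    ((hG.continuous.comp (continuous_const_smul t)).continuousOn.integrableOn_compact
      (isCompact_closedBall (0 : E) R)).mono_set (hAR.trans Metric.ball_subset_closedBall)
  have hdiff : ∀ᵐ z ∂μ.restrict A, HasDerivAt (fun s : ℝ => G (s • z))
      (fderiv ℝ G (t • z) z) t := by
    have h := (Measure.quasiMeasurePreserving_smul μ ht.ne').ae (hG.ae_differentiableAt (μ := μ))
    filter_upwards [ae_restrict_of_ae h] with z hz
    have h2 : HasDerivAt (fun s : ℝ => s • z) z t := by
      simpa using (hasDerivAt_id t).smul_const z
    exact hz.hasFDerivAt.comp_hasDerivAt t h2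
  refine (hasDerivAt_integral_of_dominated_loc_of_lip (bound := fun _ => C * R) Filter.univ_mem
    (Filter.Eventually.of_forall fun s => (hint s).aestronglyMeasurable) (hint t) ?_ ?_
    (integrableOn_const hAfin.ne) hdiff).2
  · have h1 : Measurable fun z : E => fderiv ℝ G (t • z) :=
      (measurable_fderiv ℝ G).comp (measurable_const_smul t)
    have h2 : Measurable fun z : E => fderiv ℝ G (t • z) z :=
      (isBoundedBilinearMap_apply (𝕜 := ℝ) (E := E) (F := ℝ)).continuous.measurable.comp
        (h1.prodMk measurable_id)
    exact h2.aestronglyMeasurable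
  · filter_upwards [ae_restrict_mem hA] with z hz
    refine LipschitzOnWith.of_dist_le_mul fun s _ s' _ => ?_
    have hzR : ‖z‖ < R := by simpa using hAR hz
    have hR : 0 ≤ R := (norm_nonneg z).trans hzR.le
    calc dist (G (s • z)) (G (s' • z)) ≤ C * dist (s • z) (s' • z) := hG.dist_le_mul _ _
      _ = C * (dist s s' * ‖z‖) := by
        rw [dist_eq_norm, ← sub_smul, norm_smul, dist_eq_norm]
      _ ≤ C * (dist s s' * R) := by gcongr
      _ = (Real.nnabs (C * R) : ℝ) * dist s s' := by
        rw [Real.coe_nnabs, abs_of_nonneg (by positivity)]; ring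

/-- Derivative bound for dilated averages in terms of the local `n`-energy of a majorant of
the gradient, `n` being the dimension. -/
lemma norm_setIntegral_fderiv_smul_le {G w : E → ℝ} {A : Set E} (hA : MeasurableSet A) {R : ℝ}
    (hR : 0 < R) (hAR : A ⊆ Metric.ball 0 R) (hn : Module.finrank ℝ E ≠ 0)
    (hw : ∀ᵐ x ∂μ, ‖fderiv ℝ G x‖ ≤ w x) (hw0 : ∀ x, 0 ≤ w x) {b : ℝ}
    (hwint : IntegrableOn (fun x => w x ^ Module.finrank ℝ E) (Metric.ball 0 (b * R)) μ)
    {c : ℝ} (hc : 0 < c) {t : ℝ} (ht : 0 < t) (htb : t ≤ b) :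
    ‖∫ z in A, fderiv ℝ G (t • z) z ∂μ‖ ≤
      R * (c * μ.real A + (∫ x in Metric.ball 0 (b * R), w x ^ Module.finrank ℝ E ∂μ) /
        c ^ (Module.finrank ℝ E - 1)) * t⁻¹ := by
  set n := Module.finrank ℝ E
  set H : E → ℝ := (Metric.ball 0 (b * R)).indicator fun x => w x ^ n with hH
  have hAfin : μ A < ⊤ := (measure_mono hAR).trans_lt measure_ball_lt_top
  have hHint : Integrable H μ := hwint.integrable_indicator measurableSet_ball
  have hH0 : ∀ x, 0 ≤ H x := fun x => indicator_nonneg (fun x _ => pow_nonneg (hw0 x) n) x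
  have hHt : Integrable (fun z => H (t • z)) μ := hHint.comp_smul ht.ne'
  have hbd : ∀ᵐ z ∂μ.restrict A,
      ‖fderiv ℝ G (t • z) z‖ ≤ R * t⁻¹ * (c + t ^ n / c ^ (n - 1) * H (t • z)) := by
    have h := (Measure.quasiMeasurePreserving_smul μ ht.ne').ae hw
    filter_upwards [ae_restrict_of_ae h, ae_restrict_mem hA] with z hz hzA
    have hzR : ‖z‖ < R := by simpa using hAR hzA
    have hmem : t • z ∈ Metric.ball (0 : E) (b * R) := by
      rw [mem_ball_zero_iff, norm_smul, Real.norm_of_nonneg ht.le]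
      exact mul_lt_mul' htb hzR (norm_nonneg z) (ht.trans_le htb)
    have hHz : H (t • z) = w (t • z) ^ n := indicator_of_mem hmem _
    have hy := le_add_pow_div_pow (mul_nonneg ht.le (hw0 (t • z))) hc hn
    calc ‖fderiv ℝ G (t • z) z‖ ≤ ‖fderiv ℝ G (t • z)‖ * ‖z‖ := ContinuousLinearMap.le_opNorm _ _
      _ ≤ w (t • z) * R := mul_le_mul hz hzR.le (norm_nonneg z) (hw0 _)
      _ = R * t⁻¹ * (t * w (t • z)) := by field_simp
      _ ≤ R * t⁻¹ * (c + (t * w (t • z)) ^ n / c ^ (n - 1)) := by gcongr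
      _ = _ := by rw [hHz, mul_pow]; ring
  have hscale : ∫ z, H (t • z) ∂μ = (t ^ n)⁻¹ * ∫ x, H x ∂μ := by
    rw [Measure.integral_comp_smul, abs_of_pos (by positivity), smul_eq_mul]
  have hset : ∫ z in A, H (t • z) ∂μ ≤ (t ^ n)⁻¹ * ∫ x, H x ∂μ :=
    (setIntegral_le_integral hHt (Filter.Eventually.of_forall fun z => hH0 _)).trans_eq hscale
  have hHI : ∫ x, H x ∂μ = ∫ x in Metric.ball 0 (b * R), w x ^ n ∂μ :=
    integral_indicator measurableSet_ball
  have hci : Integrable (fun _ : E => c) (μ.restrict A) := integrableOn_const hAfin.ne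
  have hHi : Integrable (fun z : E => t ^ n / c ^ (n - 1) * H (t • z)) (μ.restrict A) :=
    hHt.integrableOn.const_mul _
  calc ‖∫ z in A, fderiv ℝ G (t • z) z ∂μ‖
      ≤ ∫ z in A, R * t⁻¹ * (c + t ^ n / c ^ (n - 1) * H (t • z)) ∂μ :=
        norm_integral_le_of_norm_le ((hci.add hHi).const_mul _) hbd
    _ = R * t⁻¹ * (c * μ.real A + t ^ n / c ^ (n - 1) * ∫ z in A, H (t • z) ∂μ) := by
        rw [integral_const_mul, integral_add hci hHi, integral_const_mul, setIntegral_const,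
          smul_eq_mul, mul_comm c]
    _ ≤ R * t⁻¹ * (c * μ.real A + t ^ n / c ^ (n - 1) * ((t ^ n)⁻¹ * ∫ x, H x ∂μ)) := by gcongr
    _ = _ := by rw [hHI]; field_simp

/-- Growth of dilated averages: logarithmic in the scale, with a constant controlled by the
`n`-energy of a majorant of the gradient at the larger scale. -/
lemma setIntegral_comp_smul_sub_le {G w : E → ℝ} {C : NNReal} (hG : LipschitzWith C G)
    {A : Set E} (hA : MeasurableSet A) {R : ℝ}
    (hR : 0 < R) (hAR : A ⊆ Metric.ball 0 R) (hn : Module.finrank ℝ E ≠ 0)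
    (hw : ∀ᵐ x ∂μ, ‖fderiv ℝ G x‖ ≤ w x) (hw0 : ∀ x, 0 ≤ w x) {b : ℝ}
    (hwint : IntegrableOn (fun x => w x ^ Module.finrank ℝ E) (Metric.ball 0 (b * R)) μ)
    {c : ℝ} (hc : 0 < c) {a : ℝ} (ha : 0 < a) (hab : a ≤ b) :
    (∫ z in A, G (b • z) ∂μ) - ∫ z in A, G (a • z) ∂μ ≤
      R * (c * μ.real A + (∫ x in Metric.ball 0 (b * R), w x ^ Module.finrank ℝ E ∂μ) /
        c ^ (Module.finrank ℝ E - 1)) * (Real.log b - Real.log a) := by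
  set M := R * (c * μ.real A + (∫ x in Metric.ball 0 (b * R), w x ^ Module.finrank ℝ E ∂μ) /
        c ^ (Module.finrank ℝ E - 1)) with hM
  have hd : ∀ t : ℝ, 0 < t → HasDerivAt (fun t : ℝ => (∫ z in A, G (t • z) ∂μ) - M * Real.log t)
      ((∫ z in A, fderiv ℝ G (t • z) z ∂μ) - M * t⁻¹) t := fun t ht =>
    (hasDerivAt_setIntegral_comp_smul hG hA hAR ht).sub ((Real.hasDerivAt_log ht.ne').const_mul M)
  have hanti : AntitoneOn (fun t : ℝ => (∫ z in A, G (t • z) ∂μ) - M * Real.log t) (Icc a b) := by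
    refine antitoneOn_of_deriv_nonpos (convex_Icc a b)
      (fun t ht => (hd t (ha.trans_le ht.1)).continuousAt.continuousWithinAt)
      (fun t ht => ?_) fun t ht => ?_
    · rw [interior_Icc] at ht
      exact (hd t (ha.trans ht.1)).differentiableAt.differentiableWithinAt
    · rw [interior_Icc] at ht
      rw [(hd t (ha.trans ht.1)).deriv, sub_nonpos]
      exact (le_abs_self _).trans (norm_setIntegral_fderiv_smul_le hA hR hAR hn hw hw0 hwint hc
        (ha.trans ht.1) ht.2.le)
  have h := hanti (left_mem_Icc.2 hab) (right_mem_Icc.2 hab) hab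
  simp only at h
  linarith

/-- A Lipschitz function vanishing at the origin whose logarithmic gradient is `n`-th power
integrable on a ball, `n` being the dimension, vanishes on this ball. -/
lemma LipschitzWith.eq_zero_of_integrableOn_fderiv_div {g : E → ℝ} {K : NNReal}
    (hg : LipschitzWith K g) (hg0 : g 0 = 0) (hn : Module.finrank ℝ E ≠ 0) {R : ℝ}
    (hint : IntegrableOn (fun x => (‖fderiv ℝ g x‖ / |g x|) ^ Module.finrank ℝ E)
      (Metric.ball 0 R) μ) {y : E} (hy : y ∈ Metric.ball 0 R) : g y = 0 := by
  by_contra hgy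
  have hR : 0 < R := Metric.pos_of_mem_ball hy
  set η := |g y| / 2 with hη
  have hηpos : 0 < η := by positivity
  obtain ⟨r, hr, hrsub⟩ : ∃ r > 0, Metric.ball y r ⊆ Metric.ball 0 R ∩ {z | η < |g z|} := by
    refine Metric.isOpen_iff.1 (Metric.isOpen_ball.inter
      (isOpen_lt continuous_const hg.continuous.abs)) y ⟨hy, ?_⟩
    simp only [mem_ofPred_eq, hη]
    linarith [abs_pos.2 hgy]
  set A := Metric.ball y r with hAdef
  have hA : MeasurableSet A := measurableSet_ball
  have hAR : A ⊆ Metric.ball 0 R := fun z hz => (hrsub hz).1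
  have hAη : ∀ z ∈ A, η < |g z| := fun z hz => (hrsub hz).2
  have hAfin : μ A < ⊤ := measure_ball_lt_top
  set m := μ.real A with hm
  have hmpos : 0 < m := ENNReal.toReal_pos (Metric.measure_ball_pos μ y hr).ne' hAfin.ne
  set n := Module.finrank ℝ E with hndef
  set w : E → ℝ := fun x => ‖fderiv ℝ g x‖ / |g x| with hw
  have hw0 : ∀ x, 0 ≤ w x := fun x => by positivity
  set I : ℝ → ℝ := fun b => ∫ x in Metric.ball 0 (b * R), w x ^ n ∂μ with hI
  set c := (4 * R)⁻¹ with hcdef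
  have hc : 0 < c := by positivity
  have hballmono : ∀ b ≤ (1 : ℝ), Metric.ball (0 : E) (b * R) ⊆ Metric.ball 0 R := fun b hb =>
    Metric.ball_subset_ball (by nlinarith)
  -- a scale below which the growth rate is at most `m / 2`
  obtain ⟨s, hs, hs1, hsM⟩ : ∃ s > 0, s ≤ 1 ∧ R * (c * m + I s / c ^ (n - 1)) ≤ m / 2 := by
    have hsmall : ∃ s > 0, s ≤ 1 ∧ I s < c ^ (n - 1) * (m / (4 * R)) := by
      have hball : Filter.Tendsto (fun b : ℝ => μ (Metric.ball 0 (b * R)))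
          (nhdsWithin 0 (Ioi 0)) (nhds 0) := by
        have h1 : Filter.Tendsto (fun b : ℝ => ENNReal.ofReal ((b * R) ^ n) * μ (Metric.ball 0 1))
            (nhdsWithin 0 (Ioi 0)) (nhds 0) := by
          have h2 : Filter.Tendsto (fun b : ℝ => (b * R) ^ n) (nhdsWithin 0 (Ioi 0)) (nhds 0) := by
            have : Continuous fun b : ℝ => (b * R) ^ n := by fun_prop
            simpa [hn] using (this.tendsto 0).mono_left nhdsWithin_le_nhds
          simpa using ENNReal.Tendsto.mul_const (ENNReal.tendsto_ofReal h2)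
            (Or.inr (measure_ball_lt_top (μ := μ) (x := (0 : E)) (r := 1)).ne)
        have : Nontrivial E := Module.nontrivial_of_finrank_pos (Nat.pos_of_ne_zero hn)
        refine h1.congr' ?_
        filter_upwards [self_mem_nhdsWithin] with b hb
        exact (Measure.addHaar_ball μ 0 (mul_nonneg (le_of_lt hb) hR.le)).symm
      have hball' : Filter.Tendsto ((μ.restrict (Metric.ball 0 R)) ∘
          fun b : ℝ => Metric.ball (0 : E) (b * R)) (nhdsWithin 0 (Ioi 0)) (nhds 0) :=
        tendsto_of_tendsto_of_tendsto_of_le_of_le tendsto_const_nhds hball (fun _ => zero_le)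
          fun _ => Measure.restrict_apply_le _ _
      have hIlim := Integrable.tendsto_setIntegral_nhds_zero hint hball'
      have hev := hIlim.eventually_lt_const (show 0 < c ^ (n - 1) * (m / (4 * R)) by positivity)
      obtain ⟨s, hsI, hs⟩ := (hev.and (Ioc_mem_nhdsGT one_pos)).exists
      refine ⟨s, hs.1, hs.2, ?_⟩
      rwa [Measure.restrict_restrict_of_subset (hballmono s hs.2)] at hsI
    obtain ⟨s, hs, hs1, hsI⟩ := hsmall
    refine ⟨s, hs, hs1, ?_⟩
    have h1 : I s / c ^ (n - 1) ≤ m / (4 * R) := by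
      rw [div_le_iff₀ (by positivity), mul_comm]; exact hsI.le
    calc R * (c * m + I s / c ^ (n - 1)) ≤ R * (c * m + m / (4 * R)) := by gcongr
      _ = m / 2 := by rw [hcdef]; field_simp; norm_num
  set M₁ := R * (c * m + I 1 / c ^ (n - 1)) with hM₁
  set L := Real.log ((K * R) ^ 2 + 1) / 2 with hL
  have key : ∀ t : ℝ, 0 < t → t ≤ s →
      m * Real.log η ≤ M₁ * (- Real.log s) + m / 2 * (Real.log s - Real.log t)
        + m * (Real.log t + L) := by
    intro t ht hts
    set G : E → ℝ := fun x => Real.log (g x ^ 2 + t ^ 2) / 2 with hG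
    have hGlip : LipschitzWith (Real.toNNReal t⁻¹ * K) G :=
      (lipschitzWith_log_sq_add_sq ht).comp hg
    have hGw : ∀ᵐ x ∂μ, ‖fderiv ℝ G x‖ ≤ w x := by
      filter_upwards [hg.ae_differentiableAt (μ := μ)] with x hx
      exact norm_fderiv_log_sq_add_sq_le ht hx
    have hGint : ∀ t : ℝ, IntegrableOn (fun z => G (t • z)) A μ := fun t =>
      ((hGlip.continuous.comp (continuous_const_smul t)).continuousOn.integrableOn_compact
        (isCompact_closedBall y r)).mono_set Metric.ball_subset_closedBall
    have h1 := setIntegral_comp_smul_sub_le (μ := μ) hGlip hA hR hAR hn hGw hw0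
      (hint.mono_set (hballmono 1 le_rfl)) hc hs hs1
    have h2 := setIntegral_comp_smul_sub_le (μ := μ) hGlip hA hR hAR hn hGw hw0
      (hint.mono_set (hballmono s hs1)) hc ht hts
    have h3 : m * Real.log η ≤ ∫ z in A, G ((1 : ℝ) • z) ∂μ := by
      rw [hm, ← smul_eq_mul, ← setIntegral_const]
      refine setIntegral_mono_on (integrableOn_const hAfin.ne) (hGint 1) hA fun z hz => ?_
      have : Real.log (η ^ 2) ≤ Real.log (g z ^ 2 + t ^ 2) := by
        refine Real.log_le_log (by positivity) ?_
        nlinarith [hAη z hz, sq_abs (g z), sq_nonneg t]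
      rw [Real.log_pow] at this
      simp only [one_smul, hG]
      push_cast at this
      linarith
    have h4 : ∫ z in A, G (t • z) ∂μ ≤ m * (Real.log t + L) := by
      rw [hm, ← smul_eq_mul, ← setIntegral_const]
      refine setIntegral_mono_on (hGint t) (integrableOn_const hAfin.ne) hA fun z hz => ?_
      have hzR : ‖z‖ < R := by simpa using hAR hz
      have hgz : |g (t • z)| ≤ K * (t * R) := by
        have := hg.dist_le_mul (t • z) 0
        rw [hg0, dist_zero_right, dist_zero_right, norm_smul, Real.norm_of_nonneg ht.le] at this
        exact this.trans (by gcongr)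
      have hle : g (t • z) ^ 2 + t ^ 2 ≤ t ^ 2 * ((K * R) ^ 2 + 1) := by
        have := pow_le_pow_left₀ (abs_nonneg _) hgz 2
        rw [sq_abs] at this
        nlinarith
      have := Real.log_le_log (by positivity) hle
      rw [Real.log_mul (by positivity) (by positivity), Real.log_pow] at this
      push_cast at this
      simp only [hG, hL]
      linarith
    rw [Real.log_one, zero_sub] at h1
    have h5 : R * (c * m + I s / c ^ (n - 1)) * (Real.log s - Real.log t) ≤
        m / 2 * (Real.log s - Real.log t) :=
      mul_le_mul_of_nonneg_right hsM (sub_nonneg.2 (Real.log_le_log ht hts))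
    simp only [hM₁, hI]
    simp only [hI] at h5
    linarith
  have hlim : ∀ᶠ t : ℝ in nhdsWithin 0 (Ioi 0), Real.log t <
      2 / m * (m * Real.log η - M₁ * (- Real.log s) - m / 2 * Real.log s - m * L) :=
    Real.tendsto_log_nhdsGT_zero.eventually_lt_atBot _
  obtain ⟨t, hlt, ht0, hts⟩ := (hlim.and (Ioc_mem_nhdsGT hs)).exists
  have h := key t ht0 hts
  rw [← sub_pos] at hlt
  have h2 := mul_pos (half_pos hmpos) hlt
  have h3 : m / 2 * (2 / m * (m * Real.log η - M₁ * (- Real.log s) - m / 2 * Real.log s - m * L)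
      - Real.log t) = (m * Real.log η - M₁ * (- Real.log s) - m / 2 * Real.log s - m * L)
      - m / 2 * Real.log t := by field_simp
  rw [h3] at h2
  linarith

end Dilation

/-- Uniqueness for the gradient differential inequality: if `f` is locally Lipschitz on an
open connected `Ω ⊆ ℝⁿ`, `|∇f| ≤ V |f|` a.e. on `Ω` with `V ∈ Lⁿ_loc(Ω)`, and `f` vanishes
at a point of `Ω`, then `f ≡ 0` on `Ω`. -/
theorem stmt5 {n : ℕ} (Ω : Set (EuclideanSpace ℝ (Fin n))) (hΩ : IsOpen Ω)
    (hΩconn : IsConnected Ω)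
    (f : EuclideanSpace ℝ (Fin n) → ℝ)
    (hf : ∀ x ∈ Ω, ∃ K : NNReal, ∃ t ∈ nhds x, LipschitzOnWith K f t)
    (V : EuclideanSpace ℝ (Fin n) → ℝ)
    (hV : ∀ K : Set (EuclideanSpace ℝ (Fin n)), IsCompact K → K ⊆ Ω →
      ∫⁻ x in K, ENNReal.ofReal (V x ^ n) < ⊤)
    (hineq : ∀ᵐ x ∂(volume.restrict Ω), ‖fderiv ℝ f x‖ ≤ V x * |f x|)
    (x₀ : EuclideanSpace ℝ (Fin n)) (hx₀ : x₀ ∈ Ω) (hfx₀ : f x₀ = 0) :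
    ∀ x ∈ Ω, f x = 0 := by
  rcases eq_or_ne n 0 with rfl | hn
  · intro x _
    rwa [Subsingleton.elim x x₀]
  have hcont : ContinuousOn f Ω := fun x hx => by
    obtain ⟨K, t, ht, hK⟩ := hf x hx
    exact (hK.continuousOn.continuousAt ht).continuousWithinAt
  -- the zero set is open
  have hopen : ∀ x ∈ Ω, f x = 0 → ∀ᶠ y in nhds x, f y = 0 := by
    intro x hx hfx
    obtain ⟨K, t, ht, hK⟩ := hf x hx
    obtain ⟨R, hR, hRsub⟩ := Metric.nhds_basis_closedBall.mem_iff.1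
      (Filter.inter_mem ht (hΩ.mem_nhds hx))
    obtain ⟨g, hg, hfg⟩ := (hK.mono (hRsub.trans inter_subset_left)).extend_real
    have hfd : ∀ y ∈ Metric.ball x R, fderiv ℝ f y = fderiv ℝ g y := fun y hy =>
      Filter.EventuallyEq.fderiv_eq <| Filter.eventuallyEq_of_mem
        (Metric.isOpen_ball.mem_nhds hy) (hfg.mono Metric.ball_subset_closedBall)
    have hballΩ : Metric.ball x R ⊆ Ω :=
      Metric.ball_subset_closedBall.trans (hRsub.trans inter_subset_right)
    have hmeas : Measurable fun y => (‖fderiv ℝ g y‖ / |g y|) ^ n :=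
      (((measurable_fderiv ℝ g).norm).div hg.continuous.measurable.norm).pow_const n
    have hint : IntegrableOn (fun y => (‖fderiv ℝ g y‖ / |g y|) ^ n) (Metric.ball x R) := by
      refine ⟨hmeas.aestronglyMeasurable, ?_⟩
      rw [hasFiniteIntegral_iff_ofReal (Filter.Eventually.of_forall fun y => by positivity)]
      refine lt_of_le_of_lt ?_ ((lintegral_mono_set Metric.ball_subset_closedBall).trans_lt
        (hV _ (isCompact_closedBall x R) (hRsub.trans inter_subset_right)))
      refine lintegral_mono_ae ?_
      filter_upwards [ae_restrict_of_ae_restrict_of_subset hballΩ hineq,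
        ae_restrict_mem measurableSet_ball] with y hy hyR
      rw [hfd y hyR, hfg (Metric.ball_subset_closedBall hyR)] at hy
      rcases eq_or_ne (g y) 0 with h0 | h0
      · simp [h0, hn]
      · exact ENNReal.ofReal_le_ofReal
          (pow_le_pow_left₀ (by positivity) ((div_le_iff₀ (abs_pos.2 h0)).2 hy) n)
    have hmp := measurePreserving_add_left (volume : Measure (EuclideanSpace ℝ (Fin n))) x
    have hpre : (fun y => x + y) ⁻¹' Metric.ball x R = Metric.ball 0 R := by
      ext y; simp
    have hint' : IntegrableOn (fun y => (‖fderiv ℝ (fun y => g (x + y)) y‖ / |g (x + y)|) ^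
        Module.finrank ℝ (EuclideanSpace ℝ (Fin n))) (Metric.ball 0 R) := by
      rw [← hpre, finrank_euclideanSpace_fin]
      simp_rw [fderiv_comp_add_left]
      exact (hmp.integrableOn_comp_preimage (measurableEmbedding_addLeft x)).2 hint
    have hg' : LipschitzWith K fun y => g (x + y) := by
      simpa [Function.comp_def] using hg.comp (isometry_add_left x).lipschitz
    filter_upwards [Metric.ball_mem_nhds x hR] with y hy
    have h0 : g (x + 0) = 0 := by
      rw [add_zero, ← hfg (Metric.mem_closedBall_self hR.le), hfx]
    have h := hg'.eq_zero_of_integrableOn_fderiv_div h0 (by simpa using hn) hint'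
      (y := y - x) (by simpa [dist_eq_norm] using hy)
    rw [hfg (Metric.ball_subset_closedBall hy)]
    simpa using h
  -- connectedness
  have hsub : Ω ⊆ {x | ∀ᶠ y in nhds x, f y = 0} := by
    refine hΩconn.isPreconnected.subset_of_closure_inter_subset isOpen_setOfPred_eventually_nhds
      ⟨x₀, hx₀, hopen x₀ hx₀ hfx₀⟩ ?_
    rintro x ⟨hxcl, hxΩ⟩
    refine hopen x hxΩ ?_
    by_contra hne
    have h1 := (hcont.continuousAt (hΩ.mem_nhds hxΩ)).eventually_ne hne
    obtain ⟨y, hy, hy0⟩ := mem_closure_iff_nhds.1 hxcl _ h1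
    exact hy hy0.self_of_nhds
  exact fun x hx => (hsub hx).self_of_nhds
end

section
/- Let Ω be an open set in ℝⁿ, f locally Lipschitz on Ω, and let Z = {x ∈ Ω : f(x) = 0} with Z ≠ ∅ and Z ≠ Ω. Then for every x₀ ∈ ∂Z ∩ Ω and every r > 0 with B(x₀,r) ⊆ Ω, the integral ∫_{B(x₀,r) \ Z} (|∇f(x)|/|f(x)|)ⁿ dx diverges. -/
open MeasureTheory Set Metric

/-- Integration in polar coordinates centred at `z`. -/
theorem lintegral_eq_lintegral_toSphere {E : Type*} [NormedAddCommGroup E] [NormedSpace ℝ E]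
    [FiniteDimensional ℝ E] [Nontrivial E] [MeasurableSpace E] [BorelSpace E]
    (μ : Measure E) [μ.IsAddHaarMeasure] (z : E) {G : E → ENNReal} (hG : Measurable G) :
    ∫⁻ x, G x ∂μ = ∫⁻ ω : sphere (0 : E) 1, ∫⁻ s in Ioi (0 : ℝ),
      ENNReal.ofReal (s ^ (Module.finrank ℝ E - 1)) * G (z + s • (ω : E)) ∂volume ∂μ.toSphere := by
  have hGz : Measurable fun x => G (z + x) := hG.comp (measurable_const_add z)
  have hpolar : Measurable fun p : sphere (0 : E) 1 × Ioi (0 : ℝ) =>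
      G (z + (p.2 : ℝ) • (p.1 : E)) := by
    refine hG.comp (Continuous.measurable ?_)
    fun_prop
  calc ∫⁻ x, G x ∂μ = ∫⁻ x, G (z + x) ∂μ := (lintegral_add_left_eq_self G z).symm
    _ = ∫⁻ x in ({0}ᶜ : Set E), G (z + x) ∂μ := by rw [restrict_compl_singleton]
    _ = ∫⁻ x : ({0}ᶜ : Set E), G (z + x) ∂(μ.comap (↑)) :=
      (lintegral_subtype_comap (measurableSet_singleton _).compl fun x => G (z + x)).symm
    _ = ∫⁻ p : sphere (0 : E) 1 × Ioi (0 : ℝ), G (z + (p.2 : ℝ) • (p.1 : E))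
          ∂(μ.toSphere.prod (Measure.volumeIoiPow (Module.finrank ℝ E - 1))) := by
      rw [← μ.measurePreserving_homeomorphUnitSphereProd.lintegral_comp hpolar]
      refine lintegral_congr fun x => ?_
      have hx : ‖(x : E)‖ ≠ 0 := norm_ne_zero_iff.2 x.2
      simp [smul_smul, hx]
    _ = _ := by
      rw [lintegral_prod _ hpolar.aemeasurable]
      refine lintegral_congr fun ω => ?_
      have hω : Measurable fun s : ℝ => G (z + s • (ω : E)) := by
        refine hG.comp (Continuous.measurable ?_)
        fun_prop
      rw [Measure.volumeIoiPow]
      refine (lintegral_withDensity_eq_lintegral_mul _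
        (by fun_prop) (hω.comp measurable_subtype_coe)).trans ?_
      exact lintegral_subtype_comap measurableSet_Ioi fun s : ℝ =>
        ENNReal.ofReal (s ^ (Module.finrank ℝ E - 1)) * G (z + s • (ω : E))

/-- Young-type inequality with a small constant in front of the scale-invariant term. -/
theorem le_inv_add_pow_mul_pow {n : ℕ} (hn : n ≠ 0) {g s : ℝ} (hg : 0 ≤ g) (hs : 0 < s) :
    g ≤ 1 / 2 * s⁻¹ + 2 ^ (n - 1) * (g ^ n * s ^ (n - 1)) := by
  obtain ⟨m, rfl⟩ := Nat.exists_eq_succ_of_ne_zero hn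
  simp only [Nat.succ_eq_add_one, Nat.add_sub_cancel]
  rcases le_total (2 * (g * s)) 1 with h | h
  · have h₁ : g ≤ 1 / 2 * s⁻¹ := by
      rw [← div_eq_mul_inv, le_div_iff₀ hs]
      linarith
    have h₂ : 0 ≤ 2 ^ m * (g ^ (m + 1) * s ^ m) := by positivity
    linarith
  · have h₁ : 2 ^ m * (g ^ (m + 1) * s ^ m) = g * (2 * (g * s)) ^ m := by
      rw [mul_pow, mul_pow]
      ring
    have h₂ : g ≤ g * (2 * (g * s)) ^ m := le_mul_of_one_le_right hg (one_le_pow₀ h)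
    have h₃ : 0 ≤ 1 / 2 * s⁻¹ := by positivity
    linarith

/-- A function on `(0, ρ]` that tends to `-∞` at `0` at least as fast as the logarithm has
infinite `n`-energy with respect to the weight `s ^ (n - 1)`. -/
theorem lintegral_deriv_pow_mul_pow_eq_top {n : ℕ} (hn : n ≠ 0) {u : ℝ → ℝ} {ρ C : ℝ}
    (hρ : 0 < ρ) (hac : ∀ a ∈ Ioo 0 ρ, AbsolutelyContinuousOnInterval u a ρ)
    (hlog : ∀ s ∈ Ioo 0 ρ, u s ≤ Real.log s + C) :
    ∫⁻ s in Ioo 0 ρ, ENNReal.ofReal (|deriv u s| ^ n * s ^ (n - 1)) = ⊤ := by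
  by_contra hfin
  set h : ℝ → ℝ := fun s => |deriv u s| ^ n * s ^ (n - 1) with h_def
  have h_meas : Measurable h :=
    ((measurable_deriv u).abs.pow_const n).mul (measurable_id.pow_const _)
  have h_nonneg : 0 ≤ᵐ[volume.restrict (Ioo 0 ρ)] h := by
    filter_upwards [ae_restrict_mem measurableSet_Ioo] with s hs
    have := hs.1
    simp only [h_def, Pi.zero_apply]
    positivity
  have h_int : IntegrableOn h (Ioo 0 ρ) :=
    (lintegral_ofReal_ne_top_iff_integrable h_meas.aestronglyMeasurable h_nonneg).1 hfin
  set A := ∫ s in Ioo 0 ρ, h s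
  have key : ∀ a ∈ Ioo 0 ρ,
      u ρ - Real.log a - C ≤ 1 / 2 * (Real.log ρ - Real.log a) + 2 ^ (n - 1) * A := by
    intro a ha
    have hsub : Ioo a ρ ⊆ Ioo 0 ρ := Ioo_subset_Ioo_left ha.1.le
    have hh : IntervalIntegrable h volume a ρ :=
      (intervalIntegrable_iff_integrableOn_Ioo_of_le ha.2.le).2 (h_int.mono_set hsub)
    have hinv : IntervalIntegrable (fun s : ℝ => s⁻¹) volume a ρ := by
      refine intervalIntegrable_inv_iff.2 (Or.inr fun h0 => ?_)
      rw [uIcc_of_le ha.2.le] at h0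
      exact absurd h0.1 (not_le.2 ha.1)
    have hA : ∫ s in a..ρ, h s ≤ A := by
      rw [intervalIntegral.integral_of_le ha.2.le, integral_Ioc_eq_integral_Ioo]
      exact setIntegral_mono_set h_int h_nonneg (Filter.Eventually.of_forall hsub)
    have hle : ∫ s in a..ρ, deriv u s ≤
        ∫ s in a..ρ, (1 / 2 * s⁻¹ + 2 ^ (n - 1) * h s) := by
      refine intervalIntegral.integral_mono_on ha.2.le (hac a ha).intervalIntegrable_deriv
        ((hinv.const_mul _).add (hh.const_mul _)) fun s hs => ?_
      exact (le_abs_self _).trans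
        (le_inv_add_pow_mul_pow hn (abs_nonneg _) (ha.1.trans_le hs.1))
    rw [(hac a ha).integral_deriv_eq_sub,
      intervalIntegral.integral_add (hinv.const_mul _) (hh.const_mul _),
      intervalIntegral.integral_const_mul, intervalIntegral.integral_const_mul,
      integral_inv_of_pos ha.1 hρ, Real.log_div hρ.ne' ha.1.ne'] at hle
    have hC := hlog a ha
    have : (2 : ℝ) ^ (n - 1) * ∫ s in a..ρ, h s ≤ 2 ^ (n - 1) * A := by gcongr
    linarith
  obtain ⟨a, ha, ha'⟩ := ((Real.tendsto_log_nhdsGT_zero.eventually_lt_atBot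
    (2 * (u ρ - C - 1 / 2 * Real.log ρ - 2 ^ (n - 1) * A))).and
      (Ioo_mem_nhdsGT hρ)).exists
  have := key a ha'
  linarith

/-- The composition of the logarithm with a Lipschitz function is absolutely continuous away
from the zeros of the latter. -/
theorem LipschitzWith.absolutelyContinuousOnInterval_log {φ : ℝ → ℝ} {K : NNReal}
    (hφ : LipschitzWith K φ) {a b : ℝ} (h0 : ∀ s ∈ uIcc a b, φ s ≠ 0) :
    AbsolutelyContinuousOnInterval (fun s => Real.log (φ s)) a b := by
  obtain ⟨c, hc, hmin⟩ := isCompact_uIcc.exists_isMinOn (nonempty_uIcc (a := a) (b := b))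
    hφ.continuous.abs.continuousOn
  set m := |φ c|
  have hm : 0 < m := abs_pos.2 (h0 c hc)
  have hlog : LipschitzOnWith (Real.toNNReal m⁻¹) Real.log (Ici m) := by
    refine (convex_Ici m).lipschitzOnWith_of_nnnorm_deriv_le
      (fun x hx => Real.differentiableAt_log (hm.trans_le hx).ne') fun x hx => ?_
    rw [Real.deriv_log, ← NNReal.coe_le_coe, coe_nnnorm, Real.coe_toNNReal _ (by positivity),
      Real.norm_of_nonneg (inv_nonneg.2 (hm.trans_le hx).le)]
    exact inv_anti₀ hm hx
  have hnorm : LipschitzWith (1 * K) fun s => ‖φ s‖ := lipschitzWith_one_norm.comp hφ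
  have hcomp := hlog.comp hnorm.lipschitzOnWith (s := uIcc a b) fun s hs => hmin hs
  have hcomp_eq : (Real.log ∘ fun s => ‖φ s‖) = fun s => Real.log (φ s) := by
    ext s
    simp
  rw [hcomp_eq] at hcomp
  exact hcomp.absolutelyContinuousOnInterval

/-- If a Lipschitz function vanishes at `z` but nowhere on a ball having `z` on its boundary,
then the scale-invariant energy of its logarithm on this ball is infinite. -/
theorem LipschitzWith.lintegral_ball_fderiv_div_pow_eq_top {E : Type*} [NormedAddCommGroup E]
    [InnerProductSpace ℝ E] [FiniteDimensional ℝ E] [MeasurableSpace E] [BorelSpace E]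
    (μ : Measure E) [μ.IsAddHaarMeasure] {F : E → ℝ} {K : NNReal} (hF : LipschitzWith K F)
    {y z : E} (hyz : y ≠ z) (hz : F z = 0) (h0 : ∀ x ∈ ball y (dist y z), F x ≠ 0) :
    ∫⁻ x in ball y (dist y z),
      ENNReal.ofReal ((‖fderiv ℝ F x‖ / |F x|) ^ Module.finrank ℝ E) ∂μ = ⊤ := by
  have : Nontrivial E := ⟨y, z, hyz⟩
  set n := Module.finrank ℝ E
  have hn : n ≠ 0 := Module.finrank_pos.ne'
  set d := dist y z with hd
  have hdpos : 0 < d := dist_pos.2 hyz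
  by_contra hfin
  set G : E → ENNReal := fun x => ENNReal.ofReal ((‖fderiv ℝ F x‖ / |F x|) ^ n)
  have hG : Measurable G :=
    (((measurable_fderiv ℝ F).norm.div hF.continuous.abs.measurable).pow_const n).ennreal_ofReal
  set D : Set E := {x | DifferentiableAt ℝ F x}
  have hD : MeasurableSet D := measurableSet_of_differentiableAt ℝ F
  have hpolar : ∀ {H : E → ENNReal}, Measurable H →
      Measurable fun ω : sphere (0 : E) 1 => ∫⁻ s in Ioi (0 : ℝ),
        ENNReal.ofReal (s ^ (n - 1)) * H (z + s • (ω : E)) := by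
    intro H hH
    refine Measurable.lintegral_prod_right'
      (f := fun p : sphere (0 : E) 1 × ℝ => ENNReal.ofReal (p.2 ^ (n - 1)) *
        H (z + p.2 • (p.1 : E))) ?_
    refine Measurable.mul (by fun_prop) (hH.comp (Continuous.measurable ?_))
    fun_prop
  have hfinite : ∀ᵐ ω : sphere (0 : E) 1 ∂μ.toSphere, ∫⁻ s in Ioi (0 : ℝ),
      ENNReal.ofReal (s ^ (n - 1)) * (ball y d).indicator G (z + s • (ω : E)) < ⊤ := by
    refine ae_lt_top (hpolar (hG.indicator measurableSet_ball)) ?_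
    rw [← lintegral_eq_lintegral_toSphere μ z (hG.indicator measurableSet_ball),
      lintegral_indicator measurableSet_ball]
    exact hfin
  have hdiff : ∀ᵐ ω : sphere (0 : E) 1 ∂μ.toSphere, ∀ᵐ s ∂volume.restrict (Ioi (0 : ℝ)),
      DifferentiableAt ℝ F (z + s • (ω : E)) := by
    have hind : Measurable (Dᶜ.indicator (1 : E → ENNReal)) := measurable_one.indicator hD.compl
    have hzero : ∫⁻ x, Dᶜ.indicator (1 : E → ENNReal) x ∂μ = 0 := by
      rw [lintegral_indicator_one hD.compl]
      exact hF.ae_differentiableAt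
    rw [lintegral_eq_lintegral_toSphere μ z hind, lintegral_eq_zero_iff (hpolar hind)] at hzero
    filter_upwards [hzero] with ω hω
    have hmeas : Measurable fun s : ℝ =>
        ENNReal.ofReal (s ^ (n - 1)) * Dᶜ.indicator (1 : E → ENNReal) (z + s • (ω : E)) := by
      refine Measurable.mul (by fun_prop) (hind.comp (Continuous.measurable ?_))
      fun_prop
    rw [Pi.zero_apply, lintegral_eq_zero_iff hmeas] at hω
    filter_upwards [hω, ae_restrict_mem measurableSet_Ioi] with s hs hs0
    by_contra hsD
    have hmem : z + s • (ω : E) ∈ Dᶜ := hsD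
    have hs0 : 0 < s := hs0
    simp only [hmem, indicator_of_mem, Pi.one_apply, mul_one, Pi.zero_apply,
      ENNReal.ofReal_eq_zero] at hs
    exact (pow_pos hs0 _).not_ge hs
  have hcone : ∃ᵐ ω : sphere (0 : E) 1 ∂μ.toSphere, d / 2 < inner ℝ (ω : E) (y - z) := by
    have hopen : IsOpen {ω : sphere (0 : E) 1 | d / 2 < inner ℝ (ω : E) (y - z)} :=
      isOpen_lt continuous_const (by fun_prop)
    have hnorm : ‖y - z‖ = d := by rw [hd, dist_eq_norm]
    refine frequently_ae_iff.2 (hopen.measure_pos _ ⟨⟨d⁻¹ • (y - z), ?_⟩, ?_⟩).ne'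
    · simp [norm_smul, hnorm, abs_of_pos hdpos, hdpos.ne']
    · simp only [mem_ofPred_eq, inner_smul_left, real_inner_self_eq_norm_sq, hnorm]
      simp only [map_inv₀, conj_trivial]
      field_simp
      norm_num
  obtain ⟨ω, hωcone, hωfin, hωdiff⟩ := (hcone.and_eventually (hfinite.and hdiff)).exists
  have hω : ‖(ω : E)‖ = 1 := norm_eq_of_mem_sphere ω
  have hray : ∀ s ∈ Ioo 0 d, z + s • (ω : E) ∈ ball y d := by
    intro s hs
    have hsq : ‖z + s • (ω : E) - y‖ ^ 2 < d ^ 2 := by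
      have : z + s • (ω : E) - y = s • (ω : E) - (y - z) := by abel
      rw [this, norm_sub_sq_real, norm_smul, hω, inner_smul_left, ← dist_eq_norm y z, ← hd]
      simp only [conj_trivial, Real.norm_eq_abs, mul_one, sq_abs]
      nlinarith [hs.1, hs.2]
    rw [mem_ball, dist_eq_norm]
    exact lt_of_pow_lt_pow_left₀ 2 hdpos.le hsq
  set φ : ℝ → ℝ := fun s => F (z + s • (ω : E)) with hφ_def
  have hφ0 : ∀ s ∈ Ioo 0 d, φ s ≠ 0 := fun s hs => h0 _ (hray s hs)
  have hline : LipschitzWith 1 fun s : ℝ => z + s • (ω : E) :=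
    LipschitzWith.of_dist_le_mul fun s t => by
      simp [dist_eq_norm, ← sub_smul, norm_smul, hω]
  have hφ : LipschitzWith (K * 1) φ := hF.comp hline
  have hlog : ∀ s ∈ Ioo 0 (d / 2), Real.log (φ s) ≤ Real.log s + Real.log (K : ℝ) := by
    intro s hs
    have hs' : s ∈ Ioo 0 d := ⟨hs.1, hs.2.trans (by linarith)⟩
    have hbound : |φ s| ≤ K * s := by
      have := hφ.dist_le_mul s 0
      simpa [Real.dist_eq, hφ_def, hz, abs_of_pos hs.1] using this
    have hpos := abs_pos.2 (hφ0 s hs')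
    have hK : (K : ℝ) ≠ 0 := by
      rintro hK
      rw [hK, zero_mul] at hbound
      linarith
    rw [← Real.log_abs, add_comm, ← Real.log_mul hK hs.1.ne']
    exact Real.log_le_log hpos hbound
  have htop := lintegral_deriv_pow_mul_pow_eq_top hn (half_pos hdpos)
    (fun a ha => hφ.absolutelyContinuousOnInterval_log fun s hs => by
      rw [uIcc_of_le ha.2.le] at hs
      exact hφ0 s ⟨ha.1.trans_le hs.1, hs.2.trans_lt (half_lt_self hdpos)⟩) hlog
  refine (htop.symm.trans_le (le_trans ?_
    (lintegral_mono_set (show Ioo 0 (d / 2) ⊆ Ioi 0 from Ioo_subset_Ioi_self)))).not_gt hωfin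
  refine lintegral_mono_ae ?_
  filter_upwards [ae_restrict_of_ae_restrict_of_subset Ioo_subset_Ioi_self hωdiff,
    ae_restrict_mem measurableSet_Ioo] with s hsdiff hs
  have hs' : s ∈ Ioo 0 d := ⟨hs.1, hs.2.trans (by linarith)⟩
  have hderiv : HasDerivAt φ (fderiv ℝ F (z + s • (ω : E)) ω) s := by
    refine hsdiff.hasFDerivAt.comp_hasDerivAt s ?_
    simpa using ((hasDerivAt_id s).smul_const (ω : E)).const_add z
  have hle : |deriv (fun t => Real.log (φ t)) s| ≤
      ‖fderiv ℝ F (z + s • (ω : E))‖ / |F (z + s • (ω : E))| := by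
    rw [(hderiv.log (hφ0 s hs')).deriv, abs_div]
    refine div_le_div_of_nonneg_right ?_ (abs_nonneg _)
    simpa [hω] using (fderiv ℝ F (z + s • (ω : E))).le_opNorm ω
  have hs0 := hs.1
  rw [indicator_of_mem (hray s hs'), mul_comm (|_| ^ n), ENNReal.ofReal_mul (by positivity)]
  gcongr
  exact ENNReal.ofReal_le_ofReal (pow_le_pow_left₀ (abs_nonneg _) hle n)

/-- Localized blow-up: if `f` is locally Lipschitz on open `Ω ⊆ ℝⁿ` with zero set `Z`,
`∅ ≠ Z ≠ Ω`, then for every `x₀` in the boundary of `Z` lying in `Ω` and every ball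
`B(x₀,r) ⊆ Ω`, the integral `∫_{B(x₀,r) \ Z} (|∇f|/|f|)ⁿ dx` diverges. -/
theorem stmt11 {n : ℕ} (Ω : Set (EuclideanSpace ℝ (Fin n))) (hΩ : IsOpen Ω)
    (f : EuclideanSpace ℝ (Fin n) → ℝ)
    (hf : ∀ x ∈ Ω, ∃ K : NNReal, ∃ t ∈ nhds x, LipschitzOnWith K f t)
    (Z : Set (EuclideanSpace ℝ (Fin n))) (hZ : Z = {x ∈ Ω | f x = 0})
    (hZne : Z.Nonempty) (hZneΩ : Z ≠ Ω)
    (x₀ : EuclideanSpace ℝ (Fin n)) (hx₀ : x₀ ∈ frontier Z ∩ Ω)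
    (r : ℝ) (hr : 0 < r) (hball : ball x₀ r ⊆ Ω) :
    ∫⁻ x in ball x₀ r \ Z, ENNReal.ofReal ((‖fderiv ℝ f x‖ / |f x|) ^ n) = ⊤ := by
  obtain ⟨hfr, hxΩ⟩ := hx₀
  obtain ⟨K, t, ht, hLip⟩ := hf x₀ hxΩ
  obtain ⟨ε, hε, hεt⟩ := Metric.mem_nhds_iff.1 (Filter.inter_mem ht (ball_mem_nhds x₀ hr))
  have hεr : ball x₀ ε ⊆ ball x₀ r := hεt.trans inter_subset_right
  obtain ⟨F, hF, hfF⟩ := (hLip.mono (hεt.trans inter_subset_left)).extend_real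
  have hZiff : ∀ x ∈ ball x₀ ε, x ∈ Z ↔ F x = 0 := by
    intro x hx
    rw [hZ, mem_ofPred_eq, ← hfF hx]
    exact and_iff_right (hball (hεr hx))
  have hclosed : IsClosed {x | F x = 0} := isClosed_eq hF.continuous continuous_const
  have hFx₀ : F x₀ = 0 := by
    have hx : x₀ ∈ closure (ball x₀ ε ∩ Z) :=
      isOpen_ball.inter_closure ⟨mem_ball_self hε, frontier_subset_closure hfr⟩
    exact closure_minimal (fun x hx => (hZiff x hx.1).1 hx.2) hclosed hx
  obtain ⟨y, hyZ, hy⟩ : ∃ y ∈ Zᶜ, dist x₀ y < ε / 2 := by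
    rw [← frontier_compl] at hfr
    exact Metric.mem_closure_iff.1 (frontier_subset_closure hfr) _ (half_pos hε)
  obtain ⟨z, hz, hyz⟩ := hclosed.exists_infDist_eq_dist ⟨x₀, hFx₀⟩ y
  have hd : dist y z < ε / 2 := by
    rw [← hyz]
    exact (infDist_le_dist_of_mem (s := {x | F x = 0}) hFx₀).trans_lt (by rwa [dist_comm])
  have hsub : ball y (dist y z) ⊆ ball x₀ ε :=
    ball_subset_ball' (by rw [dist_comm y x₀]; linarith)
  have h0 : ∀ x ∈ ball y (dist y z), F x ≠ 0 := fun x hx hFx => by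
    rw [mem_ball', ← hyz] at hx
    exact (infDist_le_dist_of_mem (s := {x | F x = 0}) hFx).not_gt hx
  have hne : y ≠ z := by
    rintro rfl
    exact hyZ ((hZiff y (by rw [mem_ball']; linarith)).2 hz)
  have htop := hF.lintegral_ball_fderiv_div_pow_eq_top volume hne hz h0
  rw [finrank_euclideanSpace_fin] at htop
  rw [← top_le_iff, ← htop]
  calc ∫⁻ x in ball y (dist y z), ENNReal.ofReal ((‖fderiv ℝ F x‖ / |F x|) ^ n)
      = ∫⁻ x in ball y (dist y z), ENNReal.ofReal ((‖fderiv ℝ f x‖ / |f x|) ^ n) := by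
        refine setLIntegral_congr_fun measurableSet_ball fun x hx => ?_
        have hxε := isOpen_ball.mem_nhds (hsub hx)
        simp only [hfF (hsub hx), (hfF.eventuallyEq_of_mem hxε).fderiv_eq]
    _ ≤ ∫⁻ x in ball x₀ r \ Z, ENNReal.ofReal ((‖fderiv ℝ f x‖ / |f x|) ^ n) :=
        lintegral_mono_set fun x hx =>
          ⟨hεr (hsub hx), fun hxZ => h0 x hx ((hZiff x (hsub hx)).1 hxZ)⟩
end

section
/- Let f be locally Lipschitz on an open connected set Ω ⊆ ℝⁿ and suppose ∫_{Ω \ f⁻¹(0)} (|∇f|/|f|)ⁿ dx < ∞. Then either f never vanishes on Ω or f ≡ 0 on Ω. -/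
open MeasureTheory Set
open Metric Filter Topology NNReal Module

section Helpers

variable {E : Type*} [NormedAddCommGroup E] [NormedSpace ℝ E] [FiniteDimensional ℝ E]
  [MeasurableSpace E] [BorelSpace E] {μ : Measure E} [μ.IsAddHaarMeasure]

/-- A Lipschitz function is differentiable at almost every point of a rescaled copy of the space. -/
theorem LipschitzWith.ae_differentiableAt_comp_dilation {g : E → ℝ} {L : ℝ≥0}
    (hg : LipschitzWith L g) (x₀ : E) {s : ℝ} (hs : s ≠ 0) :
    ∀ᵐ z ∂μ, DifferentiableAt ℝ g (x₀ + s • z) :=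
  ((measurePreserving_add_left μ x₀).quasiMeasurePreserving.comp
    (Measure.quasiMeasurePreserving_smul μ hs)).ae hg.ae_differentiableAt

/-- The integral of a Lipschitz function over the dilations of a bounded set is differentiable in
the dilation parameter. -/
theorem LipschitzWith.hasDerivAt_setIntegral_dilation {g : E → ℝ} {L : ℝ≥0}
    (hg : LipschitzWith L g) (x₀ : E) {s ρ : ℝ} (hs : s ≠ 0) {D : Set E} (hD : MeasurableSet D)
    (hDρ : D ⊆ ball 0 ρ) :
    HasDerivAt (fun t : ℝ => ∫ z in D, g (x₀ + t • z) ∂μ)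
      (∫ z in D, fderiv ℝ g (x₀ + s • z) z ∂μ) s := by
  have hcont (t : ℝ) : Continuous fun z : E => g (x₀ + t • z) := hg.continuous.comp (by fun_prop)
  have hDfin : μ D < ⊤ := (measure_mono hDρ).trans_lt measure_ball_lt_top
  refine (hasDerivAt_integral_of_dominated_loc_of_lip (F := fun t z => g (x₀ + t • z))
    (bound := fun _ => L * ρ) univ_mem ?_ ?_ ?_ ?_ ?_ ?_).2
  · exact Eventually.of_forall fun t => (hcont t).aestronglyMeasurable
  · exact (((hcont s).continuousOn).integrableOn_compact (isCompact_closedBall 0 ρ)).mono_set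
      (hDρ.trans ball_subset_closedBall)
  · refine Measurable.aestronglyMeasurable ?_
    have h1 : Measurable fun z : E => fderiv ℝ g (x₀ + s • z) :=
      (measurable_fderiv ℝ g).comp (by fun_prop)
    have h2 : Measurable fun p : (E →L[ℝ] ℝ) × E => p.1 p.2 :=
      (isBoundedBilinearMap_apply (𝕜 := ℝ)).continuous.measurable
    exact h2.comp (h1.prodMk measurable_id)
  · filter_upwards [ae_restrict_mem hD] with z hz
    refine LipschitzOnWith.of_dist_le_mul fun t _ u _ => (hg.dist_le_mul _ _).trans ?_
    have hz' : ‖z‖ ≤ ρ := (mem_ball_zero_iff.1 (hDρ hz)).le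
    have hρ : 0 ≤ ρ := (norm_nonneg z).trans hz'
    rw [dist_add_left, dist_eq_norm, ← sub_smul, norm_smul, ← dist_eq_norm, Real.coe_nnabs,
      abs_of_nonneg (by positivity), mul_comm (dist t u), ← mul_assoc]
    gcongr
  · exact integrableOn_const hDfin.ne
  · filter_upwards [ae_restrict_of_ae (hg.ae_differentiableAt_comp_dilation x₀ hs)] with z hz
    have h : HasDerivAt (fun t : ℝ => x₀ + t • z) z s := by
      simpa using ((hasDerivAt_id s).smul_const z).const_add x₀
    exact hz.hasFDerivAt.comp_hasDerivAt s h

/-- Change of variables along a dilation, as an inequality for sets contained in a ball. -/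
theorem setLIntegral_dilation_le (H : E → ENNReal) (x₀ : E) {s ρ : ℝ} (hs : 0 < s)
    {D : Set E} (hDρ : D ⊆ ball 0 ρ) :
    ENNReal.ofReal (s ^ finrank ℝ E) * ∫⁻ z in D, H (x₀ + s • z) ∂μ ≤
      ∫⁻ x in ball x₀ (s * ρ), H x ∂μ := by
  have hmaps (z : E) (hz : z ∈ ball (0 : E) ρ) : x₀ + s • z ∈ ball x₀ (s * ρ) := by
    rw [mem_ball_zero_iff] at hz
    rw [mem_ball_iff_norm, add_sub_cancel_left, norm_smul, Real.norm_of_nonneg hs.le]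
    gcongr
  set k := (ball x₀ (s * ρ)).indicator H with hk
  have h1 : ∫⁻ z in D, H (x₀ + s • z) ∂μ ≤ ∫⁻ z, k (x₀ + s • z) ∂μ :=
    calc ∫⁻ z in D, H (x₀ + s • z) ∂μ ≤ ∫⁻ z in ball 0 ρ, H (x₀ + s • z) ∂μ :=
          lintegral_mono_set hDρ
      _ = ∫⁻ z in ball 0 ρ, k (x₀ + s • z) ∂μ :=
          setLIntegral_congr_fun measurableSet_ball fun z hz =>
            (indicator_of_mem (hmaps z hz) H).symm
      _ ≤ _ := setLIntegral_le_lintegral _ _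
  have h2 : ∫⁻ z, k (x₀ + s • z) ∂μ = ENNReal.ofReal (|(s ^ finrank ℝ E)⁻¹|) * ∫⁻ y, k y ∂μ := by
    have := lintegral_map_equiv (μ := μ) (fun y => k (x₀ + y))
      (Homeomorph.smul (isUnit_iff_ne_zero.2 hs.ne').unit).toMeasurableEquiv
    refine this.symm.trans ?_
    change ∫⁻ y, k (x₀ + y) ∂(Measure.map (s • ·) μ) = _
    rw [Measure.map_addHaar_smul μ hs.ne', lintegral_smul_measure, lintegral_add_left_eq_self,
      smul_eq_mul]
  calc _ ≤ ENNReal.ofReal (s ^ finrank ℝ E) *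
        (ENNReal.ofReal (|(s ^ finrank ℝ E)⁻¹|) * ∫⁻ y, k y ∂μ) := by
        gcongr; exact h1.trans h2.le
    _ = ∫⁻ y, k y ∂μ := by
        rw [← mul_assoc, ← ENNReal.ofReal_mul (by positivity), abs_of_nonneg (by positivity),
          mul_inv_cancel₀ (by positivity), ENNReal.ofReal_one, one_mul]
    _ = _ := by rw [hk, lintegral_indicator measurableSet_ball]

theorem hasDerivAt_half_log_sq_add_sq {ε : ℝ} (hε : 0 < ε) (y : ℝ) :
    HasDerivAt (fun y : ℝ => Real.log (y ^ 2 + ε ^ 2) / 2) (y / (y ^ 2 + ε ^ 2)) y := by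
  have h : y ^ 2 + ε ^ 2 ≠ 0 := by positivity
  convert! (((hasDerivAt_pow 2 y).add_const (ε ^ 2)).log h).div_const 2 using 1
  field_simp
  simp [mul_comm]

theorem exists_lipschitzWith_half_log_sq_add_sq {ε : ℝ} (hε : 0 < ε) :
    ∃ L, LipschitzWith L fun y : ℝ => Real.log (y ^ 2 + ε ^ 2) / 2 := by
  refine ⟨(1 / ε).toNNReal, lipschitzWith_of_nnnorm_deriv_le
    (fun y => (hasDerivAt_half_log_sq_add_sq hε y).differentiableAt) fun y => ?_⟩
  rw [(hasDerivAt_half_log_sq_add_sq hε y).deriv, ← NNReal.coe_le_coe,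
    Real.coe_toNNReal _ (by positivity), coe_nnnorm, Real.norm_eq_abs, abs_div,
    abs_of_pos (by positivity : 0 < y ^ 2 + ε ^ 2), div_le_div_iff₀ (by positivity) hε]
  nlinarith [sq_nonneg (|y| - ε), sq_abs y, abs_nonneg y, sq_nonneg y]

theorem norm_fderiv_half_log_sq_add_sq_le {G : Type*} [NormedAddCommGroup G] [NormedSpace ℝ G]
    {f : G → ℝ} {x : G} (hf : DifferentiableAt ℝ f x) {ε : ℝ} (hε : 0 < ε) :
    ‖fderiv ℝ (fun x => Real.log (f x ^ 2 + ε ^ 2) / 2) x‖ ≤ ‖fderiv ℝ f x‖ / |f x| := by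
  have h := (hasDerivAt_half_log_sq_add_sq hε (f x)).comp_hasFDerivAt x hf.hasFDerivAt
  have h' : fderiv ℝ (fun x => Real.log (f x ^ 2 + ε ^ 2) / 2) x =
    (f x / (f x ^ 2 + ε ^ 2)) • fderiv ℝ f x := h.fderiv
  rw [h', norm_smul, Real.norm_eq_abs, abs_div, abs_of_pos (by positivity : 0 < f x ^ 2 + ε ^ 2)]
  rcases eq_or_ne (f x) 0 with h0 | h0
  · simp [h0]
  · rw [div_eq_inv_mul ‖_‖]
    gcongr
    rw [inv_eq_one_div, div_le_div_iff₀ (by positivity) (by positivity)]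
    nlinarith [sq_abs (f x), sq_nonneg ε]

theorem le_quarter_add_pow {a : ℝ} (ha : 0 ≤ a) {n : ℕ} (hn : n ≠ 0) : a ≤ 1 / 4 + (4 * a) ^ n := by
  rcases le_total (4 * a) 1 with h | h
  · have : 0 ≤ (4 * a) ^ n := by positivity
    linarith
  · have := le_self_pow₀ h hn
    linarith

/-- Young-type bound for the derivative of the dilation averages of `log (f ^ 2 + ε ^ 2) / 2`. -/
theorem ofReal_mul_abs_setIntegral_fderiv_log_le [Nontrivial E] {f : E → ℝ} {K : ℝ≥0}
    (hf : LipschitzWith K f) (x₀ : E) {s ρ ε : ℝ} (hs : 0 < s) (hρ : 0 < ρ) (hε : 0 < ε)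
    {D : Set E} (hD : MeasurableSet D) (hDρ : D ⊆ ball 0 ρ) :
    ENNReal.ofReal (s * |∫ z in D,
        fderiv ℝ (fun x => Real.log (f x ^ 2 + ε ^ 2) / 2) (x₀ + s • z) z ∂μ|) ≤
      ENNReal.ofReal (1 / 4) * μ D + ENNReal.ofReal ((4 * ρ) ^ finrank ℝ E) *
        ∫⁻ x in ball x₀ (s * ρ),
          ENNReal.ofReal ((‖fderiv ℝ f x‖ / |f x|) ^ finrank ℝ E) ∂μ := by
  set g : E → ℝ := fun x => Real.log (f x ^ 2 + ε ^ 2) / 2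
  set q : E → ℝ := fun x => ‖fderiv ℝ f x‖ / |f x|
  set n := finrank ℝ E
  have hn : n ≠ 0 := finrank_pos.ne'
  have hpt : ∀ᵐ z ∂μ.restrict D, ENNReal.ofReal s * ‖fderiv ℝ g (x₀ + s • z) z‖ₑ ≤
      ENNReal.ofReal (1 / 4) + ENNReal.ofReal ((4 * ρ) ^ n) *
        (ENNReal.ofReal (s ^ n) * ENNReal.ofReal (q (x₀ + s • z) ^ n)) := by
    filter_upwards [ae_restrict_mem hD,
      ae_restrict_of_ae (hf.ae_differentiableAt_comp_dilation x₀ hs.ne')] with z hz hdiff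
    have hz' : ‖z‖ ≤ ρ := (mem_ball_zero_iff.1 (hDρ hz)).le
    have hq : 0 ≤ q (x₀ + s • z) := by positivity
    have h1 : ‖fderiv ℝ g (x₀ + s • z) z‖ ≤ q (x₀ + s • z) * ρ :=
      ((fderiv ℝ g (x₀ + s • z)).le_opNorm z).trans <| by
        gcongr
        exact norm_fderiv_half_log_sq_add_sq_le hdiff hε
    rw [← ofReal_norm, ← ENNReal.ofReal_mul hs.le, ← ENNReal.ofReal_mul (by positivity),
      ← ENNReal.ofReal_mul (by positivity), ← ENNReal.ofReal_add (by positivity) (by positivity)]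
    refine ENNReal.ofReal_le_ofReal ?_
    calc s * ‖fderiv ℝ g (x₀ + s • z) z‖ ≤ s * (q (x₀ + s • z) * ρ) := by gcongr
      _ ≤ 1 / 4 + (4 * (s * (q (x₀ + s • z) * ρ))) ^ n := le_quarter_add_pow (by positivity) hn
      _ = _ := by simp only [mul_pow]; ring
  have hmeas : Measurable fun z => ENNReal.ofReal (q (x₀ + s • z) ^ n) := by
    have hqm : Measurable q :=
      (measurable_fderiv ℝ f).norm.div (hf.continuous.measurable.norm)
    exact ((hqm.comp (by fun_prop : Measurable fun z : E => x₀ + s • z)).pow_const n).ennreal_ofReal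
  calc _ = ENNReal.ofReal s * ‖∫ z in D, fderiv ℝ g (x₀ + s • z) z ∂μ‖ₑ := by
        rw [ENNReal.ofReal_mul hs.le, ← ofReal_norm, Real.norm_eq_abs]
    _ ≤ ENNReal.ofReal s * ∫⁻ z in D, ‖fderiv ℝ g (x₀ + s • z) z‖ₑ ∂μ := by
        gcongr
        exact enorm_integral_le_lintegral_enorm _
    _ = ∫⁻ z in D, ENNReal.ofReal s * ‖fderiv ℝ g (x₀ + s • z) z‖ₑ ∂μ :=
        (lintegral_const_mul' _ _ ENNReal.ofReal_ne_top).symm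
    _ ≤ _ := lintegral_mono_ae hpt
    _ = ENNReal.ofReal (1 / 4) * μ D + ENNReal.ofReal ((4 * ρ) ^ n) *
        (ENNReal.ofReal (s ^ n) * ∫⁻ z in D, ENNReal.ofReal (q (x₀ + s • z) ^ n) ∂μ) := by
        rw [lintegral_add_left measurable_const, lintegral_const_mul' _ _ ENNReal.ofReal_ne_top,
          lintegral_const_mul' _ _ ENNReal.ofReal_ne_top, lintegral_const,
          Measure.restrict_apply_univ]
    _ ≤ _ := by
        gcongr
        exact setLIntegral_dilation_le (fun x => ENNReal.ofReal (q x ^ n)) x₀ hs hDρ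

/-- A function with `s * φ' s ≤ c` grows at most like `c * log s`. -/
theorem sub_le_mul_log_sub_log {φ φ' : ℝ → ℝ} {a b c : ℝ} (ha : 0 < a) (hab : a ≤ b)
    (hφ : ∀ s, 0 < s → HasDerivAt φ (φ' s) s) (hc : ∀ s ∈ Icc a b, s * φ' s ≤ c) :
    φ b - φ a ≤ c * (Real.log b - Real.log a) := by
  have hd (s : ℝ) (hs : 0 < s) : HasDerivAt (fun s => c * Real.log s - φ s) (c * s⁻¹ - φ' s) s :=
    ((Real.hasDerivAt_log hs.ne').const_mul c).sub (hφ s hs)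
  have hmono : MonotoneOn (fun s => c * Real.log s - φ s) (Icc a b) := by
    refine monotoneOn_of_deriv_nonneg (convex_Icc a b)
      (fun s hs => (hd s (ha.trans_le hs.1)).continuousAt.continuousWithinAt)
      (fun s hs => (hd s (ha.trans_le (interior_subset hs).1)).differentiableAt.differentiableWithinAt)
      fun s hs => ?_
    have hs' := interior_subset hs
    have hs0 := ha.trans_le hs'.1
    rw [(hd s hs0).deriv, sub_nonneg, ← div_eq_mul_inv, le_div_iff₀ hs0, mul_comm]
    exact hc s hs'
  have := hmono (left_mem_Icc.2 hab) (right_mem_Icc.2 hab) hab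
  simp only at this
  linarith

/-- A Lipschitz function vanishing at the center of a ball, whose logarithmic gradient is integrable
to the power of the dimension there, vanishes on the whole ball. -/
theorem LipschitzWith.eq_zero_of_lintegral_logDeriv_lt_top [Nontrivial E] {f : E → ℝ} {K : ℝ≥0}
    (hf : LipschitzWith K f) {x₀ : E} (hx₀ : f x₀ = 0) {r : ℝ} (hr : 0 < r)
    (hfin : ∫⁻ x in ball x₀ r,
      ENNReal.ofReal ((‖fderiv ℝ f x‖ / |f x|) ^ finrank ℝ E) ∂μ < ⊤) :
    ∀ x ∈ ball x₀ r, f x = 0 := by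
  by_contra! ⟨x, hx, hfx⟩
  set n := finrank ℝ E
  set H : E → ENNReal := fun x => ENNReal.ofReal ((‖fderiv ℝ f x‖ / |f x|) ^ n)
  have hm : 0 < |f x| / 2 := by positivity
  set m := |f x| / 2
  obtain ⟨κ, hκ, hκsub⟩ : ∃ κ > 0, ball x κ ⊆ ball x₀ r ∩ {y | m < |f y|} :=
    Metric.isOpen_iff.1 (isOpen_ball.inter (isOpen_lt continuous_const hf.continuous.abs)) x
      ⟨hx, half_lt_self (abs_pos.2 hfx)⟩
  set D := ball (x - x₀) κ
  have hDmem (z : E) (hz : z ∈ D) : x₀ + z ∈ ball x κ := by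
    rw [mem_ball_iff_norm] at hz ⊢
    convert hz using 2
    abel
  have hDρ : D ⊆ ball 0 r := fun z hz => by
    simpa [mem_ball_iff_norm] using (hκsub (hDmem z hz)).1
  have hD : MeasurableSet D := measurableSet_ball
  have hDfin : μ D < ⊤ := measure_ball_lt_top
  set V := μ.real D
  have hV : 0 < V := ENNReal.toReal_pos (measure_ball_pos μ _ hκ).ne' hDfin.ne
  set g : ℝ → E → ℝ := fun ε x => Real.log (f x ^ 2 + ε ^ 2) / 2
  set φ : ℝ → ℝ → ℝ := fun ε s => ∫ z in D, g ε (x₀ + s • z) ∂μ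
  set φ' : ℝ → ℝ → ℝ := fun ε s => ∫ z in D, fderiv ℝ (g ε) (x₀ + s • z) z ∂μ
  have hg (ε : ℝ) (hε : 0 < ε) : ∃ L, LipschitzWith L (g ε) := by
    obtain ⟨L, hL⟩ := exists_lipschitzWith_half_log_sq_add_sq hε
    exact ⟨_, hL.comp hf⟩
  have hφ (ε : ℝ) (hε : 0 < ε) (s : ℝ) (hs : 0 < s) : HasDerivAt (φ ε) (φ' ε s) s := by
    obtain ⟨L, hL⟩ := hg ε hε
    exact hL.hasDerivAt_setIntegral_dilation x₀ hs.ne' hD hDρ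
  have hint (ε : ℝ) (hε : 0 < ε) (s : ℝ) : IntegrableOn (fun z => g ε (x₀ + s • z)) D μ := by
    obtain ⟨L, hL⟩ := hg ε hε
    exact (((hL.continuous.comp (by fun_prop : Continuous fun z : E => x₀ + s • z)).continuousOn
      ).integrableOn_compact (isCompact_closedBall 0 r)).mono_set
        (hDρ.trans ball_subset_closedBall)
  set A : ℝ → ENNReal := fun s => ∫⁻ x in ball x₀ (s * r), H x ∂μ
  set C := (4 * r) ^ n
  have hC : 0 < C := by positivity
  have hest (ε : ℝ) (hε : 0 < ε) (s : ℝ) (hs : 0 < s) {a : ℝ} (ha : 0 ≤ a)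
      (hA : A s ≤ ENNReal.ofReal a) : s * φ' ε s ≤ V / 4 + C * a := by
    have h := ofReal_mul_abs_setIntegral_fderiv_log_le (μ := μ) hf x₀ hs hr hε hD hDρ
    have h' : ENNReal.ofReal (s * |φ' ε s|) ≤ ENNReal.ofReal (V / 4 + C * a) := by
      refine h.trans ?_
      rw [ENNReal.ofReal_add (by positivity) (by positivity), ENNReal.ofReal_mul hC.le,
        div_eq_inv_mul V, ENNReal.ofReal_mul (by norm_num), ofReal_measureReal hDfin.ne,
        one_div]
      gcongr
    have h2 := (ENNReal.ofReal_le_ofReal_iff (by positivity)).1 h'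
    exact le_trans (by gcongr; exact le_abs_self _) h2
  have hA1 (s : ℝ) (hs : s ≤ 1) : A s ≤ ENNReal.ofReal (A 1).toReal := by
    rw [ENNReal.ofReal_toReal (by simpa [A] using hfin.ne)]
    exact lintegral_mono_set (ball_subset_ball (by gcongr))
  obtain ⟨s₀, hs₀, hs₀1, hAs₀⟩ : ∃ s₀ > 0, s₀ ≤ 1 ∧
      ∀ s, s ≤ s₀ → A s ≤ ENNReal.ofReal (V / (4 * C)) := by
    obtain ⟨δ, hδ, hδA⟩ := exists_pos_setLIntegral_lt_of_measure_lt hfin.ne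
      (ENNReal.ofReal_pos.2 (by positivity : 0 < V / (4 * C))).ne'
    have hlim : Tendsto (fun s : ℝ => ENNReal.ofReal (s ^ n) * μ (ball 0 r)) (𝓝 0) (𝓝 0) := by
      have h1 : Tendsto (fun s : ℝ => ENNReal.ofReal (s ^ n)) (𝓝 0) (𝓝 0) := by
        have : Continuous fun s : ℝ => ENNReal.ofReal (s ^ n) :=
          ENNReal.continuous_ofReal.comp (continuous_pow n)
        simpa [n, finrank_pos.ne'] using this.tendsto 0
      simpa using ENNReal.Tendsto.mul_const h1 (Or.inr measure_ball_lt_top.ne)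
    obtain ⟨η, hη, hηδ⟩ := Metric.eventually_nhds_iff.1 (hlim.eventually_lt_const hδ)
    refine ⟨min 1 (η / 2), by positivity, min_le_left _ _, fun s hs => ?_⟩
    have hs' : A s ≤ A (min 1 (η / 2)) :=
      lintegral_mono_set (ball_subset_ball (by gcongr))
    refine hs'.trans ?_
    have hsub : ball x₀ (min 1 (η / 2) * r) ⊆ ball x₀ r :=
      ball_subset_ball (mul_le_of_le_one_left hr.le (min_le_left _ _))
    have hpos : 0 < min 1 (η / 2) := by positivity
    have := hδA (ball x₀ (min 1 (η / 2) * r)) <| by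
      refine (Measure.restrict_apply_le _ _).trans_lt ?_
      rw [Measure.addHaar_ball_mul_of_pos μ x₀ hpos]
      refine hηδ ?_
      rw [Real.dist_eq, sub_zero, abs_of_pos hpos]
      exact (min_le_right _ _).trans_lt (half_lt_self hη)
    rw [Measure.restrict_restrict_of_subset hsub] at this
    exact this.le
  have hlower (ε : ℝ) (hε : 0 < ε) : V * Real.log m ≤ φ ε 1 := by
    have : ∫ z in D, Real.log m ∂μ ≤ φ ε 1 := by
      refine setIntegral_mono_on (integrableOn_const hDfin.ne) (hint ε hε 1) hD fun z hz => ?_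
      have hz' : m < |f (x₀ + z)| := (hκsub (hDmem z hz)).2
      have h1 : Real.log (m ^ 2) ≤ Real.log (f (x₀ + z) ^ 2 + ε ^ 2) := by
        refine Real.log_le_log (by positivity) ?_
        rw [← sq_abs (f _)]
        have : m ^ 2 ≤ |f (x₀ + z)| ^ 2 := by gcongr
        linarith [sq_nonneg ε]
      rw [Real.log_pow] at h1
      simp only [g, one_smul]
      push_cast at h1
      linarith
    simpa [V] using this
  have hupper (s : ℝ) (hs : 0 < s) :
      φ s s ≤ V * (Real.log s + Real.log ((K * r) ^ 2 + 1) / 2) := by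
    have : φ s s ≤ ∫ z in D, (Real.log s + Real.log ((K * r) ^ 2 + 1) / 2) ∂μ := by
      refine setIntegral_mono_on (hint s hs s) (integrableOn_const hDfin.ne) hD fun z hz => ?_
      have hz' : ‖z‖ ≤ r := (mem_ball_zero_iff.1 (hDρ hz)).le
      have h1 : |f (x₀ + s • z)| ≤ K * (s * r) := by
        have := hf.dist_le_mul (x₀ + s • z) x₀
        rw [hx₀, Real.dist_eq, sub_zero, dist_self_add_left, norm_smul,
          Real.norm_of_nonneg hs.le] at this
        exact this.trans (by gcongr)
      have h2 : Real.log (f (x₀ + s • z) ^ 2 + s ^ 2) ≤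
          Real.log (s ^ 2 * ((K * r) ^ 2 + 1)) := by
        refine Real.log_le_log (by positivity) ?_
        rw [← sq_abs (f _)]
        calc _ ≤ (K * (s * r)) ^ 2 + s ^ 2 := by gcongr
          _ = _ := by ring
      rw [Real.log_mul (by positivity) (by positivity), Real.log_pow] at h2
      simp only [g]
      push_cast at h2
      linarith
    simpa [V] using this
  have hmain (s : ℝ) (hs : 0 < s) (hss₀ : s ≤ s₀) :
      V * Real.log m ≤ V * (Real.log s + Real.log ((K * r) ^ 2 + 1) / 2) +
        V / 2 * (Real.log s₀ - Real.log s) +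
        (V / 4 + C * (A 1).toReal) * (Real.log 1 - Real.log s₀) := by
    have h1 := sub_le_mul_log_sub_log hs hss₀ (hφ s hs) (c := V / 2) fun t ht => by
      refine (hest s hs t (hs.trans_le ht.1) (by positivity) (hAs₀ t ht.2)).trans_eq ?_
      field_simp
      norm_num
    have h2 := sub_le_mul_log_sub_log hs₀ hs₀1 (hφ s hs) fun t ht =>
      hest s hs t (hs₀.trans_le ht.1) ENNReal.toReal_nonneg (hA1 t ht.2)
    linarith [hlower s hs, hupper s hs]
  have hbot : Tendsto (fun s => V / 2 * Real.log s) (𝓝[>] 0) atBot :=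
    Real.tendsto_log_nhdsGT_zero.const_mul_atBot (by positivity)
  obtain ⟨s, hs1, hs2, hs3⟩ := ((hbot.eventually_lt_atBot (V * Real.log m -
    (V * (Real.log ((K * r) ^ 2 + 1) / 2) + V / 2 * Real.log s₀ +
      (V / 4 + C * (A 1).toReal) * (Real.log 1 - Real.log s₀)))).and
        (Ioc_mem_nhdsGT hs₀)).exists
  linarith [hmain s hs2 hs3]

end Helpers

/-- Contrapositive of the main theorem: if `f` is locally Lipschitz on an open connected
`Ω ⊆ ℝⁿ` and `∫_{Ω \ f⁻¹(0)} (|∇f|/|f|)ⁿ dx < ∞`, then `f` never vanishes on `Ω` or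
`f ≡ 0` on `Ω`. -/
theorem stmt16 {n : ℕ} (Ω : Set (EuclideanSpace ℝ (Fin n))) (hΩ : IsOpen Ω)
    (hΩconn : IsConnected Ω)
    (f : EuclideanSpace ℝ (Fin n) → ℝ)
    (hf : ∀ x ∈ Ω, ∃ K : NNReal, ∃ t ∈ nhds x, LipschitzOnWith K f t)
    (hfin : ∫⁻ x in Ω \ f ⁻¹' {0}, ENNReal.ofReal ((‖fderiv ℝ f x‖ / |f x|) ^ n) < ⊤) :
    (∀ x ∈ Ω, f x ≠ 0) ∨ (∀ x ∈ Ω, f x = 0) := by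
  rcases n.eq_zero_or_pos with rfl | hn
  · obtain ⟨x, -⟩ := hΩconn.nonempty
    by_cases hx : f x = 0
    · exact Or.inr fun y _ => Subsingleton.elim x y ▸ hx
    · exact Or.inl fun y _ => Subsingleton.elim x y ▸ hx
  have : Nonempty (Fin n) := ⟨⟨0, hn⟩⟩
  have hcont : ContinuousOn f Ω := fun x hx => by
    obtain ⟨K, t, ht, hK⟩ := hf x hx
    exact (hK.continuousOn.continuousAt ht).continuousWithinAt
  have hzero : IsOpen (Ω ∩ f ⁻¹' {0}) := by
    refine Metric.isOpen_iff.2 fun x₀ ⟨hx₀, hfx₀⟩ => ?_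
    obtain ⟨K, t, ht, hK⟩ := hf x₀ hx₀
    obtain ⟨r, hr, hsub⟩ := Metric.mem_nhds_iff.1 (inter_mem ht (hΩ.mem_nhds hx₀))
    obtain ⟨F, hF, hFf⟩ := (hK.mono (hsub.trans inter_subset_left)).extend_real
    have hFx₀ : F x₀ = 0 := (hFf (mem_ball_self hr)).symm.trans hfx₀
    refine ⟨r, hr, fun x hx => ⟨(hsub hx).2, (hFf hx).trans ?_⟩⟩
    refine hF.eq_zero_of_lintegral_logDeriv_lt_top (μ := volume) hFx₀ hr ?_ x hx
    rw [finrank_euclideanSpace_fin]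
    calc ∫⁻ x in ball x₀ r, ENNReal.ofReal ((‖fderiv ℝ F x‖ / |F x|) ^ n)
        = ∫⁻ x in ball x₀ r, ENNReal.ofReal ((‖fderiv ℝ f x‖ / |f x|) ^ n) := by
          refine setLIntegral_congr_fun measurableSet_ball fun y hy => ?_
          have hy' : f =ᶠ[𝓝 y] F := hFf.eventuallyEq_of_mem (isOpen_ball.mem_nhds hy)
          simp only [hy'.fderiv_eq, hFf hy]
      _ ≤ ∫⁻ x in Ω \ f ⁻¹' {0}, ENNReal.ofReal ((‖fderiv ℝ f x‖ / |f x|) ^ n) := by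
          rw [← lintegral_inter_add_sdiff _ (ball x₀ r)
            (hF.continuous.measurable (measurableSet_singleton (0 : ℝ)))]
          have h0 : ∫⁻ x in ball x₀ r ∩ F ⁻¹' {0},
              ENNReal.ofReal ((‖fderiv ℝ f x‖ / |f x|) ^ n) = 0 := by
            refine setLIntegral_eq_zero (measurableSet_ball.inter
              (hF.continuous.measurable (measurableSet_singleton 0))) fun y hy => ?_
            have : f y = 0 := (hFf hy.1).trans hy.2
            simp [this, hn.ne']
          rw [h0, zero_add]
          exact lintegral_mono_set fun y hy =>
            ⟨(hsub hy.1).2, fun h => hy.2 ((hFf hy.1).symm.trans h)⟩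
      _ < ⊤ := hfin
  have hne : IsOpen (Ω ∩ f ⁻¹' {0}ᶜ) :=
    hcont.isOpen_inter_preimage hΩ isOpen_compl_singleton
  by_contra! ⟨⟨x, hx, hfx⟩, y, hy, hfy⟩
  obtain ⟨z, -, hz1, hz2⟩ := hΩconn.isPreconnected _ _ hzero hne
    (fun z hz => (eq_or_ne (f z) 0).imp (fun h => ⟨hz, h⟩) fun h => ⟨hz, h⟩)
    ⟨x, hx, hx, hfx⟩ ⟨y, hy, hy, hfy⟩
  exact hz2.2 hz1.2
end
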